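/- Let F = (f_1,…,f_n) be an S-M system on B, with n ≥ 2. Fix an index i ∈ {1,…,n} and a value c ∈ [a_i, b_i]. Then the restricted square system (f_1|_{x_i=c}, …, f_{n-1}|_{x_i=c}), viewed as n−1 functions of the remaining n−1 variables, is an S-M system on the reduced box ∏_{k ≠ i} [a_k, b_k]. -/

import Mathlib

/-- The partial derivative `∂f/∂x_i` at `p`. -/
noncomputable def pd {m : ℕ} (f : (Fin m → ℝ) → ℝ) (i : Fin m) (p : Fin m → ℝ) : ℝ :=
  fderiv ℝ f p (Pi.single i 1)

/-- `f` is continuously differentiable on an open set containing `B`. -/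
def C1On {m : ℕ} (f : (Fin m → ℝ) → ℝ) (B : Set (Fin m → ℝ)) : Prop :=
  ∃ U : Set (Fin m → ℝ), IsOpen U ∧ B ⊆ U ∧ ContDiffOn ℝ 1 f U

/-- `F = (f_1,…,f_m)` is an S-M system on `B ⊆ ℝ^m`: for every `k ∈ {1,…,m}`,
every strictly increasing choice of `k` column indices `c`, and all points
`q_1,…,q_k ∈ B`, the `k × k` matrix with `(j,l)`-entry `(∂f_j/∂x_{c l})(q j)`
has nonzero determinant.  (`k` is represented as `k'+1` with `k'+1 ≤ m`.) -/
def SMSystem (m : ℕ) (f : Fin m → (Fin m → ℝ) → ℝ) (B : Set (Fin m → ℝ)) : Prop :=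
  ∀ (k : ℕ) (hk : k + 1 ≤ m) (c : Fin (k+1) → Fin m), StrictMono c →
    ∀ q : Fin (k+1) → (Fin m → ℝ), (∀ j, q j ∈ B) →
      (Matrix.of fun j l : Fin (k+1) => pd (f (Fin.castLE hk j)) (c l) (q j)).det ≠ 0

/-- The linear map that inserts `0` as the `i`-th coordinate. -/
noncomputable def insertNthZero {m : ℕ} (i : Fin (m + 1)) :
    (Fin m → ℝ) →L[ℝ] (Fin (m + 1) → ℝ) :=
  ContinuousLinearMap.pi
    (i.insertNth (α := fun _ => (Fin m → ℝ) →L[ℝ] ℝ) 0 fun k => ContinuousLinearMap.proj k)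

/-- Inserting a constant `i`-th coordinate is differentiable; its derivative inserts `0`. -/
theorem hasFDerivAt_insertNth_const {m : ℕ} (i : Fin (m + 1)) (c : ℝ) (y : Fin m → ℝ) :
    HasFDerivAt (fun y : Fin m → ℝ => (i.insertNth c y : Fin (m + 1) → ℝ))
      (insertNthZero i) y := by
  rw [hasFDerivAt_pi']
  intro j
  refine Fin.succAboveCases i ?_ (fun k => ?_) j
  · have h : ContinuousLinearMap.proj i ∘L insertNthZero i = 0 := by
      ext; simp [insertNthZero]
    simpa [h] using hasFDerivAt_const c y
  · have h : ContinuousLinearMap.proj (i.succAbove k) ∘L insertNthZero i =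
        ContinuousLinearMap.proj k := by
      ext; simp [insertNthZero]
    simpa [h] using hasFDerivAt_apply k y

/-- Partial derivatives commute with freezing the `i`-th coordinate. -/
theorem pd_comp_insertNth {m : ℕ} {g : (Fin (m + 1) → ℝ) → ℝ} {i : Fin (m + 1)} {c : ℝ}
    {y : Fin m → ℝ} (hg : DifferentiableAt ℝ g (i.insertNth c y)) (l : Fin m) :
    pd (fun y => g (i.insertNth c y)) l y = pd g (i.succAbove l) (i.insertNth c y) := by
  have h := hg.hasFDerivAt.comp y (hasFDerivAt_insertNth_const i c y)
  have hv : insertNthZero i (Pi.single l 1) = Pi.single (i.succAbove l) 1 := by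
    ext j
    refine Fin.succAboveCases i ?_ (fun k => ?_) j
    · simp [insertNthZero]
    · simp [insertNthZero, Pi.single_apply]
  have h' : fderiv ℝ (fun y => g (i.insertNth c y)) y = _ := h.fderiv
  simp only [pd, h', ContinuousLinearMap.comp_apply, hv]

theorem C1On.differentiableAt {m : ℕ} {g : (Fin m → ℝ) → ℝ} {B : Set (Fin m → ℝ)}
    (hg : C1On g B) {p : Fin m → ℝ} (hp : p ∈ B) : DifferentiableAt ℝ g p := by
  obtain ⟨U, hU, hBU, hgU⟩ := hg
  exact (hgU.differentiableOn one_ne_zero).differentiableAt (hU.mem_nhds (hBU hp))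

/-- If `F = (f_1,…,f_n)` is an S-M system on `B` and we substitute `x_i = c`
(with `c ∈ [a i, b i]`), then the first `n-1` restricted functions, viewed as
functions of the remaining `n-1` variables, form an S-M system on the reduced
box `∏_{k ≠ i} [a k, b k]`. -/
theorem SMSystem.restrict (n : ℕ) (a b : Fin (n+2) → ℝ)
    (hab : ∀ i, a i < b i) (f : Fin (n+2) → (Fin (n+2) → ℝ) → ℝ)
    (hC1 : ∀ j, C1On (f j) (Set.Icc a b))
    (hSM : SMSystem (n+2) f (Set.Icc a b))
    (i : Fin (n+2)) (c : ℝ) (hc : c ∈ Set.Icc (a i) (b i)) :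
    SMSystem (n+1)
      (fun (j : Fin (n+1)) (y : Fin (n+1) → ℝ) => f j.castSucc (i.insertNth c y))
      (Set.Icc (fun k => a (i.succAbove k)) (fun k => b (i.succAbove k))) := by
  intro k hk col hcol q hq
  have hmem : ∀ j, (i.insertNth c (q j) : Fin (n + 2) → ℝ) ∈ Set.Icc a b := fun j =>
    Fin.insertNth_mem_Icc.2 ⟨hc, hq j⟩
  have h := hSM k (by omega) (fun l => i.succAbove (col l))
    ((Fin.strictMono_succAbove i).comp hcol) (fun j => i.insertNth c (q j)) hmem
  convert h using 5 with j l
  exact pd_comp_insertNth ((hC1 _).differentiableAt (hmem j)) (col l)
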